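/- arXiv:2009.08207 — 2 statements merged into one kernel-verified Lean document; each statement's English description precedes it below -/
import Mathlib

section
/- Let d ≥ 1, let p, e, s : (0,∞)×(0,∞) → ℝ be continuously differentiable functions satisfying Gibbs' equation with ∂s/∂ϑ ≠ 0 everywhere, and let H : 𝓔 → ℝ be differentiable on an open set 𝓔 ⊆ ℝ² containing the range of (ϱ,ϑ) ↦ (ϱ, ϱ·s(ϱ,ϑ)) with H(ϱ, ϱ·s(ϱ,ϑ)) = ϱ·e(ϱ,ϑ) for all ϱ,ϑ > 0. Define the total energy E(ϱ,m,S) = |m|²/(2ϱ) + H(ϱ,S) for ϱ > 0, m ∈ ℝ^d, (ϱ,S) ∈ 𝓔. Then for all ϱ,ϑ,ϱ̃,ϑ̃ > 0 and u,ũ ∈ ℝ^d, the Bregman distance of E between the state (ϱ, ϱu, ϱ·s(ϱ,ϑ)) and the state (ϱ̃, ϱ̃ũ, ϱ̃·s(ϱ̃,ϑ̃)), i.e. E(ϱ,ϱu,ϱs(ϱ,ϑ)) − DE(ϱ̃,ϱ̃ũ,ϱ̃s(ϱ̃,ϑ̃))·((ϱ,ϱu,ϱs(ϱ,ϑ)) −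 (ϱ̃,ϱ̃ũ,ϱ̃s(ϱ̃,ϑ̃))) − E(ϱ̃,ϱ̃ũ,ϱ̃s(ϱ̃,ϑ̃)), equals the relative energy in standard variables: (1/2)ϱ|u−ũ|² + H_{ϑ̃}(ϱ,ϑ) − (∂H_{ϑ̃}/∂ϱ)(ϱ̃,ϑ̃)·(ϱ−ϱ̃) − H_{ϑ̃}(ϱ̃,ϑ̃), where H_{ϑ̃}(ϱ,ϑ) = ϱ(e(ϱ,ϑ) − ϑ̃·s(ϱ,ϑ)) and ∂H_{ϑ̃}/∂ϱ denotes the partial derivative in ϱ at fixed ϑ = ϑ̃. -/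
open Set Filter Topology

noncomputable section

/-- The open positive quadrant `(0,∞) × (0,∞)` in the `(ϱ,ϑ)`-plane. -/
def posQuad : Set (ℝ × ℝ) := {q : ℝ × ℝ | 0 < q.1 ∧ 0 < q.2}

/-- Partial derivative of a two-variable function in the first (density) variable. -/
def pd1 (f : ℝ → ℝ → ℝ) (ρ θ : ℝ) : ℝ :=
  fderiv ℝ (fun q : ℝ × ℝ => f q.1 q.2) (ρ, θ) (1, 0)

/-- Partial derivative of a two-variable function in the second (temperature) variable. -/
def pd2 (f : ℝ → ℝ → ℝ) (ρ θ : ℝ) : ℝ :=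
  fderiv ℝ (fun q : ℝ × ℝ => f q.1 q.2) (ρ, θ) (0, 1)

/-- Gibbs' equation in the standard variables. -/
def GibbsEq (p e s : ℝ → ℝ → ℝ) : Prop :=
  ∀ ρ θ : ℝ, 0 < ρ → 0 < θ →
    θ * pd2 s ρ θ = pd2 e ρ θ ∧
    θ * pd1 s ρ θ = pd1 e ρ θ - p ρ θ / ρ ^ 2

/-- A function that is `C¹` on the open quadrant is differentiable at each of its points. -/
theorem differentiableAt_of_contDiffOn_posQuad {f : ℝ → ℝ → ℝ}
    (hf : ContDiffOn ℝ 1 (fun q : ℝ × ℝ => f q.1 q.2) posQuad)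
    {ρ θ : ℝ} (hρ : 0 < ρ) (hθ : 0 < θ) :
    DifferentiableAt ℝ (fun q : ℝ × ℝ => f q.1 q.2) (ρ, θ) := by
  have ho : IsOpen posQuad :=
    (isOpen_lt continuous_const continuous_fst).inter (isOpen_lt continuous_const continuous_snd)
  exact (hf.differentiableOn one_ne_zero).differentiableAt (ho.mem_nhds ⟨hρ, hθ⟩)

theorem hasDerivAt_pd1 {f : ℝ → ℝ → ℝ} {ρ θ : ℝ}
    (hf : DifferentiableAt ℝ (fun q : ℝ × ℝ => f q.1 q.2) (ρ, θ)) :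
    HasDerivAt (fun r => f r θ) (pd1 f ρ θ) ρ :=
  hf.hasFDerivAt.comp_hasDerivAt (f := fun r : ℝ => (r, θ)) ρ ((hasDerivAt_id ρ).prodMk (hasDerivAt_const ρ θ))

theorem hasDerivAt_pd2 {f : ℝ → ℝ → ℝ} {ρ θ : ℝ}
    (hf : DifferentiableAt ℝ (fun q : ℝ × ℝ => f q.1 q.2) (ρ, θ)) :
    HasDerivAt (fun t => f ρ t) (pd2 f ρ θ) θ :=
  hf.hasFDerivAt.comp_hasDerivAt θ ((hasDerivAt_const θ ρ).prodMk (hasDerivAt_id θ))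

theorem continuousLinearMap_prod_apply (L : ℝ × ℝ →L[ℝ] ℝ) (a b : ℝ) :
    L (a, b) = a * L (1, 0) + b * L (0, 1) := by
  have h : ((a, b) : ℝ × ℝ) = a • ((1, 0) : ℝ × ℝ) + b • ((0, 1) : ℝ × ℝ) := by simp
  rw [h, map_add, map_smul, map_smul, smul_eq_mul, smul_eq_mul]

/-- The derivative of the internal energy in the entropy variable is the temperature. -/
theorem fderiv_internalEnergy_entropy {e s : ℝ → ℝ → ℝ} {H : ℝ × ℝ → ℝ} {ρ θ : ℝ}
    (hρ : 0 < ρ) (hθ : 0 < θ)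
    (he : DifferentiableAt ℝ (fun q : ℝ × ℝ => e q.1 q.2) (ρ, θ))
    (hs : DifferentiableAt ℝ (fun q : ℝ × ℝ => s q.1 q.2) (ρ, θ))
    (hgibbs : θ * pd2 s ρ θ = pd2 e ρ θ) (hsθ : pd2 s ρ θ ≠ 0)
    (hH : DifferentiableAt ℝ H (ρ, ρ * s ρ θ))
    (hHe : ∀ t : ℝ, 0 < t → H (ρ, ρ * s ρ t) = ρ * e ρ t) :
    fderiv ℝ H (ρ, ρ * s ρ θ) (0, 1) = θ := by
  have h1 : HasDerivAt (fun t => H (ρ, ρ * s ρ t))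
      (fderiv ℝ H (ρ, ρ * s ρ θ) (0, ρ * pd2 s ρ θ)) θ :=
    hH.hasFDerivAt.comp_hasDerivAt θ
      ((hasDerivAt_const θ ρ).prodMk ((hasDerivAt_pd2 hs).const_mul ρ))
  have h2 : HasDerivAt (fun t => H (ρ, ρ * s ρ t)) (ρ * pd2 e ρ θ) θ :=
    ((hasDerivAt_pd2 he).const_mul ρ).congr_of_eventuallyEq
      ((lt_mem_nhds hθ).mono fun t ht => hHe t ht)
  have h3 := h1.unique h2
  rw [continuousLinearMap_prod_apply, ← hgibbs] at h3
  have h4 : ρ * pd2 s ρ θ ≠ 0 := mul_ne_zero hρ.ne' hsθ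
  apply mul_left_cancel₀ h4
  linarith

/-- The derivative of the internal energy in the density variable is the derivative of the
ballistic free energy in the density. -/
theorem hasDerivAt_ballisticEnergy {e s : ℝ → ℝ → ℝ} {H : ℝ × ℝ → ℝ} {ρ θ : ℝ} (hρ : 0 < ρ)
    (hs : DifferentiableAt ℝ (fun q : ℝ × ℝ => s q.1 q.2) (ρ, θ))
    (hH : DifferentiableAt ℝ H (ρ, ρ * s ρ θ))
    (hHS : fderiv ℝ H (ρ, ρ * s ρ θ) (0, 1) = θ)
    (hHe : ∀ r : ℝ, 0 < r → H (r, r * s r θ) = r * e r θ) :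
    HasDerivAt (fun r => r * (e r θ - θ * s r θ)) (fderiv ℝ H (ρ, ρ * s ρ θ) (1, 0)) ρ := by
  have hS : HasDerivAt (fun r => r * s r θ) (1 * s ρ θ + ρ * pd1 s ρ θ) ρ :=
    (hasDerivAt_id ρ).mul (hasDerivAt_pd1 hs)
  have h1 : HasDerivAt (fun r => H (r, r * s r θ))
      (fderiv ℝ H (ρ, ρ * s ρ θ) (1, 1 * s ρ θ + ρ * pd1 s ρ θ)) ρ :=
    hH.hasFDerivAt.comp_hasDerivAt ρ ((hasDerivAt_id ρ).prodMk hS)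
  have h2 := (h1.sub (hS.const_mul θ)).congr_of_eventuallyEq
    (f₁ := fun r => r * (e r θ - θ * s r θ))
    ((lt_mem_nhds hρ).mono fun r hr => by
      simp only [Pi.sub_apply, hHe r hr]; ring)
  rw [continuousLinearMap_prod_apply _ 1, hHS] at h2
  exact h2.congr_deriv (by ring)

/-- The total derivative of the total energy in the conservative-entropy variables. -/
theorem fderiv_totalEnergy_apply {V : Type*} [NormedAddCommGroup V] [InnerProductSpace ℝ V]
    {H : ℝ × ℝ → ℝ} {ρ S : ℝ} (hρ : ρ ≠ 0) (m : V) (hH : DifferentiableAt ℝ H (ρ, S))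
    (r : ℝ) (n : V) (σ : ℝ) :
    fderiv ℝ (fun x : ℝ × V × ℝ => ‖x.2.1‖ ^ 2 / (2 * x.1) + H (x.1, x.2.2)) (ρ, m, S) (r, n, σ)
      = inner ℝ m n / ρ - ‖m‖ ^ 2 / (2 * ρ ^ 2) * r + fderiv ℝ H (ρ, S) (r, σ) := by
  have hfst : HasFDerivAt (fun x : ℝ × V × ℝ => x.1) (ContinuousLinearMap.fst ℝ ℝ (V × ℝ))
      (ρ, m, S) := hasFDerivAt_fst
  have hsnd : HasFDerivAt (fun x : ℝ × V × ℝ => x.2) (ContinuousLinearMap.snd ℝ ℝ (V × ℝ))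
      (ρ, m, S) := hasFDerivAt_snd
  have hinv := (hasDerivAt_inv (x := 2 * ρ) (by positivity)).comp_hasFDerivAt
    (ρ, m, S) (hfst.const_mul 2)
  have hE := (hsnd.fst.norm_sq.mul hinv).add
    (HasFDerivAt.comp (ρ, m, S) (g := H) hH.hasFDerivAt (hfst.prodMk hsnd.snd))
  have hE' : HasFDerivAt (fun x : ℝ × V × ℝ => ‖x.2.1‖ ^ 2 / (2 * x.1) + H (x.1, x.2.2)) _
      (ρ, m, S) := hE
  rw [hE'.fderiv]
  simp
  field_simp
  ring

/-- the Bregman distance of the total energy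
`E(ϱ,m,S) = |m|²/(2ϱ) + H(ϱ,S)` between the states `(ϱ, ϱu, ϱ s(ϱ,ϑ))` and
`(ϱ̃, ϱ̃ũ, ϱ̃ s(ϱ̃,ϑ̃))` coincides with the relative energy in the standard variables. -/
theorem relative_energy_is_bregman_distance
    (d : ℕ) (hd : 1 ≤ d)
    (p e s : ℝ → ℝ → ℝ)
    (hp : ContDiffOn ℝ 1 (fun q : ℝ × ℝ => p q.1 q.2) posQuad)
    (he : ContDiffOn ℝ 1 (fun q : ℝ × ℝ => e q.1 q.2) posQuad)
    (hs : ContDiffOn ℝ 1 (fun q : ℝ × ℝ => s q.1 q.2) posQuad)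
    (hGibbs : GibbsEq p e s)
    (hsθ : ∀ ρ θ : ℝ, 0 < ρ → 0 < θ → pd2 s ρ θ ≠ 0)
    (𝓔 : Set (ℝ × ℝ)) (h𝓔 : IsOpen 𝓔)
    (hrange : ∀ ρ θ : ℝ, 0 < ρ → 0 < θ → (ρ, ρ * s ρ θ) ∈ 𝓔)
    (H : ℝ × ℝ → ℝ) (hH : DifferentiableOn ℝ H 𝓔)
    (hHe : ∀ ρ θ : ℝ, 0 < ρ → 0 < θ → H (ρ, ρ * s ρ θ) = ρ * e ρ θ) :
    ∀ (ρ θ ρ' θ' : ℝ) (u u' : EuclideanSpace ℝ (Fin d)),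
      0 < ρ → 0 < θ → 0 < ρ' → 0 < θ' →
      (fun x : ℝ × EuclideanSpace ℝ (Fin d) × ℝ =>
            ‖x.2.1‖ ^ 2 / (2 * x.1) + H (x.1, x.2.2)) (ρ, ρ • u, ρ * s ρ θ)
        - fderiv ℝ
            (fun x : ℝ × EuclideanSpace ℝ (Fin d) × ℝ =>
              ‖x.2.1‖ ^ 2 / (2 * x.1) + H (x.1, x.2.2))
            (ρ', ρ' • u', ρ' * s ρ' θ')
            ((ρ, ρ • u, ρ * s ρ θ) - (ρ', ρ' • u', ρ' * s ρ' θ'))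
        - (fun x : ℝ × EuclideanSpace ℝ (Fin d) × ℝ =>
            ‖x.2.1‖ ^ 2 / (2 * x.1) + H (x.1, x.2.2)) (ρ', ρ' • u', ρ' * s ρ' θ')
      = 1 / 2 * ρ * ‖u - u'‖ ^ 2
        + ρ * (e ρ θ - θ' * s ρ θ)
        - deriv (fun r : ℝ => r * (e r θ' - θ' * s r θ')) ρ' * (ρ - ρ')
        - ρ' * (e ρ' θ' - θ' * s ρ' θ') := by
  intro ρ θ ρ' θ' u u' hρ hθ hρ' hθ'
  have hs' := differentiableAt_of_contDiffOn_posQuad hs hρ' hθ'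
  have he' := differentiableAt_of_contDiffOn_posQuad he hρ' hθ'
  have hH' := hH.differentiableAt (h𝓔.mem_nhds (hrange ρ' θ' hρ' hθ'))
  have hHS := fderiv_internalEnergy_entropy hρ' hθ' he' hs' (hGibbs ρ' θ' hρ' hθ').1
    (hsθ ρ' θ' hρ' hθ') hH' fun t ht => hHe ρ' t hρ' ht
  rw [(hasDerivAt_ballisticEnergy hρ' hs' hH' hHS fun r hr => hHe r θ' hr hθ').deriv]
  simp only [Prod.mk_sub_mk]
  rw [fderiv_totalEnergy_apply hρ'.ne' _ hH', continuousLinearMap_prod_apply, hHS,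
    hHe ρ θ hρ hθ, hHe ρ' θ' hρ' hθ', norm_sub_sq_real, inner_sub_right]
  simp only [real_inner_smul_left, real_inner_smul_right, real_inner_self_eq_norm_sq, norm_smul,
    Real.norm_eq_abs, mul_pow, sq_abs, real_inner_comm u u']
  field_simp
  ring

end
end

section
/- Let d ≥ 1 and let U ⊆ ℝ × ℝ^d be open. Let ϱ, ϑ : U → ℝ be continuously differentiable with ϱ > 0 and ϑ > 0 on U, let u, q : U → ℝ^d be continuously differentiable, and let 𝕊 : U → ℝ^{d×d} be continuous. Let p, e, s : (0,∞)×(0,∞) → ℝ be continuously differentiable functions satisfying Gibbs' equation. Suppose that at every point of U the continuity equation ∂_t ϱ + div_x(ϱu) = 0 and the internal energy equation ∂_t(ϱ·e(ϱ,ϑ)) + div_x(ϱ·e(ϱ,ϑ)·u) + div_x q = 𝕊 : ∇_x u − p(ϱ,ϑ)·div_x u hold. Then at every point of U the entropy equation holds: ∂_t(ϱ·s(ϱ,ϑ)) + div_x(ϱ·s(ϱ,ϑ)·u) + div_x(q/ϑ) = (1/ϑ)·( 𝕊 : ∇_x u − (q·∇_x ϑ)/ϑ ). -/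
open Set Filter Topology

noncomputable section

/-- Time derivative `∂_t f` of a scalar field on `ℝ × ℝᵈ` (time × space). -/
def dt {d : ℕ} (f : ℝ × (Fin d → ℝ) → ℝ) (z : ℝ × (Fin d → ℝ)) : ℝ :=
  fderiv ℝ f z (1, 0)

/-- Spatial partial derivative `∂_{x_i} f` of a scalar field. -/
def dxi {d : ℕ} (i : Fin d) (f : ℝ × (Fin d → ℝ) → ℝ) (z : ℝ × (Fin d → ℝ)) : ℝ :=
  fderiv ℝ f z (0, Pi.single i 1)

/-- Spatial divergence `div_x w` of a vector field. -/
def divx {d : ℕ} (w : ℝ × (Fin d → ℝ) → Fin d → ℝ) (z : ℝ × (Fin d → ℝ)) : ℝ :=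
  ∑ i, dxi i (fun y => w y i) z

/-- The convective derivative `∂_t f + u · ∇_x f`. -/
def convDeriv {d : ℕ} (u : ℝ × (Fin d → ℝ) → Fin d → ℝ) (f : ℝ × (Fin d → ℝ) → ℝ)
    (z : ℝ × (Fin d → ℝ)) : ℝ :=
  dt f z + ∑ i, u z i * dxi i f z

lemma dxi_mul {d : ℕ} (i : Fin d) {f g : ℝ × (Fin d → ℝ) → ℝ} {z : ℝ × (Fin d → ℝ)}
    (hf : DifferentiableAt ℝ f z) (hg : DifferentiableAt ℝ g z) :
    dxi i (fun y => f y * g y) z = f z * dxi i g z + g z * dxi i f z := by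
  simp [dxi, fderiv_fun_mul hf hg]

lemma dt_mul {d : ℕ} {f g : ℝ × (Fin d → ℝ) → ℝ} {z : ℝ × (Fin d → ℝ)}
    (hf : DifferentiableAt ℝ f z) (hg : DifferentiableAt ℝ g z) :
    dt (fun y => f y * g y) z = f z * dt g z + g z * dt f z := by
  simp [dt, fderiv_fun_mul hf hg]

lemma divx_smul {d : ℕ} {f : ℝ × (Fin d → ℝ) → ℝ} {w : ℝ × (Fin d → ℝ) → Fin d → ℝ}
    {z : ℝ × (Fin d → ℝ)} (hf : DifferentiableAt ℝ f z) (hw : DifferentiableAt ℝ w z) :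
    divx (fun y i => f y * w y i) z = f z * divx w z + ∑ i, w z i * dxi i f z := by
  rw [differentiableAt_pi] at hw
  simp only [divx, Finset.mul_sum, ← Finset.sum_add_distrib]
  exact Finset.sum_congr rfl fun i _ => dxi_mul i hf (hw i)

lemma dt_add_divx_smul {d : ℕ} {f : ℝ × (Fin d → ℝ) → ℝ}
    {u : ℝ × (Fin d → ℝ) → Fin d → ℝ} {z : ℝ × (Fin d → ℝ)}
    (hf : DifferentiableAt ℝ f z) (hu : DifferentiableAt ℝ u z) :
    dt f z + divx (fun y i => f y * u y i) z = convDeriv u f z + f z * divx u z := by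
  rw [divx_smul hf hu, convDeriv]
  ring

lemma convDeriv_mul {d : ℕ} (u : ℝ × (Fin d → ℝ) → Fin d → ℝ)
    {f g : ℝ × (Fin d → ℝ) → ℝ} {z : ℝ × (Fin d → ℝ)}
    (hf : DifferentiableAt ℝ f z) (hg : DifferentiableAt ℝ g z) :
    convDeriv u (fun y => f y * g y) z = f z * convDeriv u g z + g z * convDeriv u f z := by
  simp only [convDeriv, dt_mul hf hg, dxi_mul _ hf hg, mul_add, Finset.mul_sum,
    Finset.sum_add_distrib, mul_left_comm (u z _)]
  ring

lemma dxi_inv {d : ℕ} (i : Fin d) {f : ℝ × (Fin d → ℝ) → ℝ} {z : ℝ × (Fin d → ℝ)}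
    (hf : DifferentiableAt ℝ f z) (hz : f z ≠ 0) :
    dxi i (fun y => (f y)⁻¹) z = -dxi i f z / f z ^ 2 := by
  have h : HasFDerivAt (fun y => (f y)⁻¹) (-(f z ^ 2)⁻¹ • fderiv ℝ f z) z :=
    (hasDerivAt_inv hz).comp_hasFDerivAt z hf.hasFDerivAt
  simp only [dxi, h.fderiv, smul_apply, smul_eq_mul]
  ring

lemma divx_div {d : ℕ} {f : ℝ × (Fin d → ℝ) → ℝ} {w : ℝ × (Fin d → ℝ) → Fin d → ℝ}
    {z : ℝ × (Fin d → ℝ)} (hf : DifferentiableAt ℝ f z) (hw : DifferentiableAt ℝ w z)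
    (hz : f z ≠ 0) :
    divx (fun y i => w y i / f y) z
      = divx w z / f z - (∑ i, w z i * dxi i f z) / f z ^ 2 := by
  simp only [div_eq_inv_mul (w _ _) (f _)]
  rw [divx_smul (hf.fun_inv hz) hw]
  simp only [dxi_inv _ hf hz, mul_div_assoc', mul_neg, neg_div, Finset.sum_neg_distrib,
    ← Finset.sum_div]
  ring

lemma isOpen_posQuad : IsOpen posQuad :=
  (isOpen_lt continuous_const continuous_fst).inter (isOpen_lt continuous_const continuous_snd)

section Composition

variable {d : ℕ} {ϱ ϑ : ℝ × (Fin d → ℝ) → ℝ} {g : ℝ → ℝ → ℝ} {z : ℝ × (Fin d → ℝ)}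

lemma fderiv_comp_two (hg : DifferentiableAt ℝ (fun x : ℝ × ℝ => g x.1 x.2) (ϱ z, ϑ z))
    (hϱ : DifferentiableAt ℝ ϱ z) (hϑ : DifferentiableAt ℝ ϑ z) (v : ℝ × (Fin d → ℝ)) :
    fderiv ℝ (fun y => g (ϱ y) (ϑ y)) z v
      = pd1 g (ϱ z) (ϑ z) * fderiv ℝ ϱ z v + pd2 g (ϱ z) (ϑ z) * fderiv ℝ ϑ z v := by
  have h : HasFDerivAt (fun y => g (ϱ y) (ϑ y)) _ z :=
    HasFDerivAt.comp (f := fun y => (ϱ y, ϑ y)) z hg.hasFDerivAt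
      (hϱ.hasFDerivAt.prodMk hϑ.hasFDerivAt)
  have hv : (fderiv ℝ ϱ z v, fderiv ℝ ϑ z v)
      = fderiv ℝ ϱ z v • ((1, 0) : ℝ × ℝ) + fderiv ℝ ϑ z v • ((0, 1) : ℝ × ℝ) := by
    simp
  rw [h.fderiv, ContinuousLinearMap.comp_apply, ContinuousLinearMap.prod_apply, hv, map_add,
    map_smul, map_smul, pd1, pd2, smul_eq_mul, smul_eq_mul]
  ring

lemma convDeriv_comp_two (u : ℝ × (Fin d → ℝ) → Fin d → ℝ)
    (hg : DifferentiableAt ℝ (fun x : ℝ × ℝ => g x.1 x.2) (ϱ z, ϑ z))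
    (hϱ : DifferentiableAt ℝ ϱ z) (hϑ : DifferentiableAt ℝ ϑ z) :
    convDeriv u (fun y => g (ϱ y) (ϑ y)) z
      = pd1 g (ϱ z) (ϑ z) * convDeriv u ϱ z + pd2 g (ϱ z) (ϑ z) * convDeriv u ϑ z := by
  simp only [convDeriv, dt, dxi, fderiv_comp_two hg hϱ hϑ, mul_add, Finset.mul_sum,
    Finset.sum_add_distrib, mul_left_comm (u z _)]
  ring

/-- Under the continuity equation, `∂_t(ϱg) + div_x(ϱgu)` is `ϱ` times the convective
derivative of `g = g(ϱ,ϑ)`. -/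
lemma dt_add_divx_of_continuity {u : ℝ × (Fin d → ℝ) → Fin d → ℝ}
    (hg : DifferentiableAt ℝ (fun x : ℝ × ℝ => g x.1 x.2) (ϱ z, ϑ z))
    (hϱ : DifferentiableAt ℝ ϱ z) (hϑ : DifferentiableAt ℝ ϑ z) (hu : DifferentiableAt ℝ u z)
    (hcont : convDeriv u ϱ z + ϱ z * divx u z = 0) :
    dt (fun y => ϱ y * g (ϱ y) (ϑ y)) z
        + divx (fun y i => ϱ y * g (ϱ y) (ϑ y) * u y i) z
      = ϱ z * (pd1 g (ϱ z) (ϑ z) * convDeriv u ϱ z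
          + pd2 g (ϱ z) (ϑ z) * convDeriv u ϑ z) := by
  have hgc : DifferentiableAt ℝ (fun y => g (ϱ y) (ϑ y)) z :=
    DifferentiableAt.comp (f := fun y => (ϱ y, ϑ y)) z hg (hϱ.prodMk hϑ)
  rw [dt_add_divx_smul (hϱ.fun_mul hgc) hu, convDeriv_mul u hϱ hgc, convDeriv_comp_two u hg hϱ hϑ]
  linear_combination g (ϱ z) (ϑ z) * hcont

end Composition

/-- smooth solutions of the continuity equation and the internal energy
balance, with thermodynamic functions satisfying Gibbs' equation, satisfy the entropy
equation `∂_t(ϱs) + div_x(ϱsu) + div_x(q/ϑ) = (1/ϑ)(𝕊 : ∇_x u − q·∇_xϑ/ϑ)`. -/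
theorem entropy_equation_from_internal_energy
    (d : ℕ) (hd : 1 ≤ d) (U : Set (ℝ × (Fin d → ℝ))) (hU : IsOpen U)
    (ϱ ϑ : ℝ × (Fin d → ℝ) → ℝ) (u q : ℝ × (Fin d → ℝ) → Fin d → ℝ)
    (𝕊 : ℝ × (Fin d → ℝ) → Fin d → Fin d → ℝ)
    (hϱ : ContDiffOn ℝ 1 ϱ U) (hϑ : ContDiffOn ℝ 1 ϑ U)
    (hϱpos : ∀ z ∈ U, 0 < ϱ z) (hϑpos : ∀ z ∈ U, 0 < ϑ z)
    (hu : ContDiffOn ℝ 1 u U) (hq : ContDiffOn ℝ 1 q U)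
    (h𝕊 : ContinuousOn 𝕊 U)
    (p e s : ℝ → ℝ → ℝ)
    (hp : ContDiffOn ℝ 1 (fun x : ℝ × ℝ => p x.1 x.2) posQuad)
    (he : ContDiffOn ℝ 1 (fun x : ℝ × ℝ => e x.1 x.2) posQuad)
    (hs : ContDiffOn ℝ 1 (fun x : ℝ × ℝ => s x.1 x.2) posQuad)
    (hGibbs : GibbsEq p e s)
    (hcont : ∀ z ∈ U, dt ϱ z + divx (fun y i => ϱ y * u y i) z = 0)
    (hener : ∀ z ∈ U,
      dt (fun y => ϱ y * e (ϱ y) (ϑ y)) z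
        + divx (fun y i => ϱ y * e (ϱ y) (ϑ y) * u y i) z
        + divx q z
      = (∑ i, ∑ j, 𝕊 z i j * dxi j (fun y => u y i) z)
        - p (ϱ z) (ϑ z) * divx u z) :
    ∀ z ∈ U,
      dt (fun y => ϱ y * s (ϱ y) (ϑ y)) z
        + divx (fun y i => ϱ y * s (ϱ y) (ϑ y) * u y i) z
        + divx (fun y i => q y i / ϑ y) z
      = 1 / ϑ z * ((∑ i, ∑ j, 𝕊 z i j * dxi j (fun y => u y i) z)
          - (∑ i, q z i * dxi i ϑ z) / ϑ z) := by
  intro z hz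
  have hdiff {E : Type} [NormedAddCommGroup E] [NormedSpace ℝ E]
      {f : ℝ × (Fin d → ℝ) → E} (hf : ContDiffOn ℝ 1 f U) : DifferentiableAt ℝ f z :=
    (hf.contDiffAt (hU.mem_nhds hz)).differentiableAt one_ne_zero
  have hstate {g : ℝ → ℝ → ℝ} (hg : ContDiffOn ℝ 1 (fun x : ℝ × ℝ => g x.1 x.2) posQuad) :
      DifferentiableAt ℝ (fun x : ℝ × ℝ => g x.1 x.2) (ϱ z, ϑ z) :=
    (hg.contDiffAt (isOpen_posQuad.mem_nhds ⟨hϱpos z hz, hϑpos z hz⟩)).differentiableAt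
      one_ne_zero
  have hϱ0 : ϱ z ≠ 0 := (hϱpos z hz).ne'
  have hϑ0 : ϑ z ≠ 0 := (hϑpos z hz).ne'
  have hmass := hcont z hz
  rw [dt_add_divx_smul (hdiff hϱ) (hdiff hu)] at hmass
  have henergy := hener z hz
  rw [dt_add_divx_of_continuity (hstate he) (hdiff hϱ) (hdiff hϑ) (hdiff hu) hmass] at henergy
  rw [dt_add_divx_of_continuity (hstate hs) (hdiff hϱ) (hdiff hϑ) (hdiff hu) hmass,
    divx_div (hdiff hϑ) (hdiff hq) hϑ0]
  obtain ⟨hGϑ, hGϱ⟩ := hGibbs (ϱ z) (ϑ z) (hϱpos z hz) (hϑpos z hz)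
  have hGϱ' : pd1 e (ϱ z) (ϑ z) = ϑ z * pd1 s (ϱ z) (ϑ z) + p (ϱ z) (ϑ z) / ϱ z ^ 2 := by
    linarith
  rw [← hGϑ, hGϱ', eq_neg_of_add_eq_zero_left hmass] at henergy
  rw [eq_neg_of_add_eq_zero_left hmass]
  generalize (∑ i, ∑ j, 𝕊 z i j * dxi j (fun y => u y i) z) = D at *
  field_simp at henergy ⊢
  linear_combination ϑ z * henergy

end
end
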